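/- (Lane–Kharchenko) For every finite subgroup G of GL_m(K), the algebra of invariants K⟨x_1,…,x_m⟩^G is a free associative algebra, i.e. it is isomorphic as a K-algebra to the free associative algebra on some set of free generators. -/

import Mathlib

open Matrix

/-- The action of a matrix `g` on the free associative algebra `K⟨x_1,…,x_m⟩` by linear
substitution of the free generators: `x_j ↦ ∑ i, g i j • x_i`. -/
noncomputable def freeAct (K : Type*) [CommSemiring K] {m : ℕ}
    (g : Matrix (Fin m) (Fin m) K) :
    FreeAlgebra K (Fin m) →ₐ[K] FreeAlgebra K (Fin m) :=
  FreeAlgebra.lift K fun j => ∑ i, g i j • FreeAlgebra.ι K i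

/-- The subalgebra of invariants `K⟨x_1,…,x_m⟩^G` of a subgroup `G` of `GL_m(K)`. -/
noncomputable def freeInvariants (K : Type*) [Field K] {m : ℕ}
    (G : Subgroup (GL (Fin m) K)) : Subalgebra K (FreeAlgebra K (Fin m)) :=
  ⨅ g ∈ G, AlgHom.equalizer
    (freeAct K ((g : GL (Fin m) K) : Matrix (Fin m) (Fin m) K)) (AlgHom.id K _)

open DirectSum

namespace FreeAlgebra

section Filtration

variable (K : Type*) [Field K] (ι : Type*)

/-- The span of the words of length less than `n` in the free algebra. -/
noncomputable def wordsLT : ℕ → Submodule K (FreeAlgebra K ι)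
  | 0 => ⊥
  | n + 1 => 1 ⊔ ⨆ i, (wordsLT n).map (LinearMap.mulLeft K (FreeAlgebra.ι K i))

theorem wordsLT_mono : Monotone (wordsLT K ι) := by
  refine monotone_nat_of_le_succ fun n => ?_
  induction n with
  | zero => exact bot_le
  | succ n ih => exact sup_le_sup_left (iSup_mono fun i => Submodule.map_mono ih) _

variable {K ι}

theorem exists_mul_mem_wordsLT (a p : FreeAlgebra K ι) (hp : ∃ n, p ∈ wordsLT K ι n) :
    ∃ n, a * p ∈ wordsLT K ι n := by
  induction a using FreeAlgebra.induction generalizing p with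
  | grade0 r =>
    obtain ⟨n, hn⟩ := hp
    exact ⟨n, by rw [← Algebra.smul_def]; exact Submodule.smul_mem _ _ hn⟩
  | grade1 i =>
    obtain ⟨n, hn⟩ := hp
    exact ⟨n + 1, Submodule.mem_sup_right (Submodule.mem_iSup_of_mem i ⟨p, hn, rfl⟩)⟩
  | mul a b iha ihb => rw [mul_assoc]; exact iha _ (ihb _ hp)
  | add a b iha ihb =>
    obtain ⟨k, hk⟩ := iha p hp
    obtain ⟨l, hl⟩ := ihb p hp
    refine ⟨max k l, ?_⟩
    rw [add_mul]
    exact add_mem (wordsLT_mono K ι (le_max_left k l) hk) (wordsLT_mono K ι (le_max_right k l) hl)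

theorem exists_mem_wordsLT (p : FreeAlgebra K ι) : ∃ n, p ∈ wordsLT K ι n := by
  simpa using exists_mul_mem_wordsLT p 1
    ⟨1, Submodule.mem_sup_left (Submodule.one_le.mp le_rfl)⟩

theorem exists_eq_algebraMap_add_sum_of_mem_wordsLT_succ {n : ℕ} {p : FreeAlgebra K ι}
    (hp : p ∈ wordsLT K ι (n + 1)) :
    ∃ (c : K) (s : Finset ι) (q : ι → FreeAlgebra K ι), (∀ i, q i ∈ wordsLT K ι n) ∧
      p = algebraMap K _ c + ∑ i ∈ s, FreeAlgebra.ι K i * q i := by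
  obtain ⟨x, hx, y, hy, rfl⟩ := Submodule.mem_sup.mp hp
  obtain ⟨c, rfl⟩ := Submodule.mem_one.mp hx
  obtain ⟨f, hf, rfl⟩ := (Submodule.mem_iSup_iff_exists_finsupp _ _).mp hy
  choose q hq hqf using hf
  exact ⟨c, f.support, q, hq, by simp only [Finsupp.sum, ← hqf, LinearMap.mulLeft_apply]⟩

/-- If the `X i` together with `1` are right linearly independent over the subalgebra `R`
which contains them (with scalar coefficients for `1`), then they are free generators. -/
theorem lift_injective_of_rightIndependent {A : Type*} [Ring A] [Algebra K A]
    {R : Subalgebra K A} {X : ι → A} (hX : ∀ i, X i ∈ R)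
    (hind : ∀ (c : K) (s : Finset ι) (b : ι → A), (∀ i, b i ∈ R) →
      algebraMap K A c + ∑ i ∈ s, X i * b i = 0 → c = 0 ∧ ∀ i ∈ s, b i = 0) :
    Function.Injective (lift K X) := by
  rw [injective_iff_map_eq_zero]
  have hmem (q : FreeAlgebra K ι) : lift K X q ∈ R := by
    have : (lift K X).range ≤ R := by
      rw [← Algebra.adjoin_range_eq_range_freeAlgebra_lift, Algebra.adjoin_le_iff]
      rintro _ ⟨i, rfl⟩
      exact hX i
    exact this ⟨q, rfl⟩
  have key (n : ℕ) : ∀ p ∈ wordsLT K ι n, lift K X p = 0 → p = 0 := by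
    induction n with
    | zero => exact fun p hp _ => (Submodule.mem_bot K).mp hp
    | succ n ih =>
      intro p hp h0
      obtain ⟨c, s, q, hq, rfl⟩ := exists_eq_algebraMap_add_sum_of_mem_wordsLT_succ hp
      have h := hind c s (fun i => lift K X (q i)) (fun i => hmem _) (by simpa using h0)
      rw [h.1, map_zero, zero_add]
      exact Finset.sum_eq_zero fun i hi => by rw [ih _ (hq i) (h.2 i hi), mul_zero]
  intro p hp
  obtain ⟨n, hn⟩ := exists_mem_wordsLT p
  exact key n p hn hp

end Filtration

section Grading

variable (K : Type*) [Field K] (ι : Type*)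

/-- The span of the free generators. -/
noncomputable abbrev linearPart : Submodule K (FreeAlgebra K ι) :=
  Submodule.span K (Set.range (FreeAlgebra.ι K))

variable {ι} in
theorem ι_mem_linearPart (i : ι) : FreeAlgebra.ι K i ∈ linearPart K ι :=
  Submodule.subset_span ⟨i, rfl⟩

/-- The generators, as elements of the degree one part of the graded free algebra. -/
noncomputable def gradedι (i : ι) : ⨁ n : ℕ, ↥(linearPart K ι ^ n) :=
  DirectSum.of (fun n : ℕ => ↥(linearPart K ι ^ n)) 1
    ⟨FreeAlgebra.ι K i, by simpa only [pow_one] using ι_mem_linearPart K i⟩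

/-- The free algebra is graded by the powers of the span of its generators. -/
noncomputable instance gradedAlgebra :
    GradedAlgebra ((linearPart K ι ^ ·) : ℕ → Submodule K (FreeAlgebra K ι)) :=
  GradedAlgebra.ofAlgHom _ (lift K (gradedι K ι))
    (by
      ext i
      simp [gradedι])
    fun n x => by
      obtain ⟨x, hx⟩ := x
      dsimp only [DirectSum.lof_eq_of]
      induction hx using Submodule.pow_induction_on_left' with
      | algebraMap r =>
        rw [AlgHom.commutes, DirectSum.algebraMap_apply]; rfl
      | add x y i hx hy ihx ihy =>
        rw [map_add, ihx, ihy, ← map_add]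
        rfl
      | mem_mul m hm i x hx ih =>
        induction hm using Submodule.span_induction with
        | mem m h =>
          obtain ⟨j, rfl⟩ := h
          rw [map_mul, ih, lift_ι_apply, gradedι, DirectSum.of_mul_of]
          exact DirectSum.of_eq_of_gradedMonoid_eq (Sigma.subtype_ext (add_comm _ _) rfl)
        | zero =>
          simp only [zero_mul, map_zero]
          exact (map_zero _).symm
        | add u v hu hv ihu ihv =>
          simp only [add_mul, map_add] at ihu ihv ⊢
          rw [ihu, ihv, ← map_add]
          rfl
        | smul c u hu ihu =>
          simp only [smul_mul_assoc, map_smul]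
          rw [ihu, ← DirectSum.lof_eq_of K, ← map_smul]
          rfl

end Grading

section Transduction

variable {K : Type*} [Field K] {ι : Type*}

variable (K ι) in
/-- Induction over the words of length `n + 1`, splitting off the last letter. -/
theorem mem_pow_succ_induction {n : ℕ} (S : Submodule K (FreeAlgebra K ι))
    (h : ∀ a ∈ linearPart K ι ^ n, ∀ y, a * FreeAlgebra.ι K y ∈ S) :
    linearPart K ι ^ (n + 1) ≤ S := by
  rw [pow_succ, Submodule.mul_le]
  intro a ha v hv
  have : linearPart K ι ≤ S.comap (LinearMap.mulLeft K a) := by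
    rw [Submodule.span_le]
    rintro _ ⟨y, rfl⟩
    exact h a ha y
  exact this hv

theorem algebraMapInv_of_mem_pow_succ {n : ℕ} {b : FreeAlgebra K ι}
    (hb : b ∈ linearPart K ι ^ (n + 1)) : algebraMapInv b = 0 := by
  have := mem_pow_succ_induction K ι (LinearMap.ker (algebraMapInv (R := K)).toLinearMap)
    (fun a ha y => by simp [algebraMapInv]) hb
  simpa using this

variable [DecidableEq ι]

/-- The homomorphism `a ↦ !![a, ∂ a; 0, ε a]`, where `∂` strips the letter `x` from the right
of the words ending in `x` and kills the other words, and `ε` is the constant term. -/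
noncomputable def stripHom (x : ι) :
    FreeAlgebra K ι →ₐ[K] Matrix (Fin 2) (Fin 2) (FreeAlgebra K ι) :=
  lift K fun y => !![FreeAlgebra.ι K y, if y = x then 1 else 0; 0, 0]

/-- The linear map stripping the letter `x` from the right of the words ending in `x`,
and killing the other words. -/
noncomputable def strip (x : ι) : FreeAlgebra K ι →ₗ[K] FreeAlgebra K ι where
  toFun a := stripHom x a 0 1
  map_add' a b := by simp
  map_smul' c a := by simp

theorem stripHom_entries (x : ι) (a : FreeAlgebra K ι) :
    stripHom x a 0 0 = a ∧ stripHom x a 1 0 = 0 ∧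
      stripHom x a 1 1 = algebraMap K _ (algebraMapInv a) := by
  induction a using FreeAlgebra.induction with
  | grade0 r => simp [Matrix.algebraMap_matrix_apply, algebraMapInv]
  | grade1 i => simp [stripHom, algebraMapInv]
  | mul a b iha ihb => simp [Matrix.mul_apply, iha, ihb]
  | add a b iha ihb => simp [iha, ihb]

theorem strip_mul (x : ι) (a b : FreeAlgebra K ι) :
    strip x (a * b) = a * strip x b + algebraMapInv b • strip x a := by
  simp [strip, Matrix.mul_apply, stripHom_entries x a, stripHom_entries x b,
    Algebra.smul_def, Algebra.commutes]

theorem strip_ι (x y : ι) : strip x (FreeAlgebra.ι K y) = if y = x then 1 else 0 := by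
  simp [strip, stripHom]

theorem strip_mul_of_mem_pow_succ (x : ι) {n : ℕ} (a : FreeAlgebra K ι) {b : FreeAlgebra K ι}
    (hb : b ∈ linearPart K ι ^ (n + 1)) : strip x (a * b) = a * strip x b := by
  rw [strip_mul, algebraMapInv_of_mem_pow_succ hb, zero_smul, add_zero]

theorem strip_mul_ι (x y : ι) (a : FreeAlgebra K ι) :
    strip x (a * FreeAlgebra.ι K y) = if y = x then a else 0 := by
  rw [strip_mul, strip_ι]
  simp [algebraMapInv]

theorem strip_mem_pow (x : ι) {n : ℕ} {b : FreeAlgebra K ι}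
    (hb : b ∈ linearPart K ι ^ (n + 1)) : strip x b ∈ linearPart K ι ^ n := by
  refine mem_pow_succ_induction K ι ((linearPart K ι ^ n).comap (strip x)) (fun a ha y => ?_) hb
  rw [Submodule.mem_comap, strip_mul_ι]
  split_ifs
  exacts [ha, zero_mem _]

theorem sum_strip_mul_ι [Fintype ι] {n : ℕ} {b : FreeAlgebra K ι}
    (hb : b ∈ linearPart K ι ^ (n + 1)) : ∑ x, strip x b * FreeAlgebra.ι K x = b := by
  have := mem_pow_succ_induction K ι
    (LinearMap.eqLocus (∑ x, LinearMap.mulRight K (FreeAlgebra.ι K x) ∘ₗ strip x) LinearMap.id)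
    (fun a ha y => by simp [strip_mul_ι, ite_mul]) hb
  simpa using this

/-- A nonzero homogeneous element can be turned into `1` by an operator which is
left linear on elements of sufficiently high degree. -/
theorem exists_transduction [Fintype ι] {k : ℕ} {b : FreeAlgebra K ι}
    (hb : b ∈ linearPart K ι ^ k) (hb0 : b ≠ 0) :
    ∃ τ : FreeAlgebra K ι →ₗ[K] FreeAlgebra K ι, τ b = 1 ∧
      ∀ j, ∀ b' ∈ linearPart K ι ^ (j + k), τ b' ∈ linearPart K ι ^ j ∧
        ∀ a, τ (a * b') = a * τ b' := by
  induction k generalizing b with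
  | zero =>
    rw [pow_zero] at hb
    obtain ⟨c, rfl⟩ := Submodule.mem_one.mp hb
    have hc : c ≠ 0 := by rintro rfl; simp at hb0
    refine ⟨c⁻¹ • LinearMap.id, ?_, fun j b' hb' => ⟨?_, fun a => ?_⟩⟩
    · simp [Algebra.smul_def, ← map_mul, hc]
    · exact Submodule.smul_mem _ _ hb'
    · simp
  | succ k ih =>
    obtain ⟨x, hx⟩ : ∃ x, strip x b ≠ 0 := by
      by_contra! h
      exact hb0 (by rw [← sum_strip_mul_ι hb]; simp [h])
    obtain ⟨τ, hτ1, hτ⟩ := ih (strip_mem_pow x hb) hx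
    refine ⟨τ ∘ₗ strip x, hτ1, fun j b' hb' => ?_⟩
    rw [← add_assoc] at hb'
    obtain ⟨h1, h2⟩ := hτ j _ (strip_mem_pow x hb')
    exact ⟨h1, fun a => by simp [strip_mul_of_mem_pow_succ x a hb', h2]⟩

end Transduction

end FreeAlgebra

section GradedGenerators

variable {K A ι : Type*} [Field K] [Ring A] [Algebra K A]

/-- The degree `n` part of the subalgebra `R`. -/
def gradedPart (𝒜 : ℕ → Submodule K A) (R : Subalgebra K A) (n : ℕ) : Submodule K A :=
  Subalgebra.toSubmodule R ⊓ 𝒜 n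

/-- The span of the products of two elements of `R` of positive degrees adding up to `n`. -/
def decomposables (𝒜 : ℕ → Submodule K A) (R : Subalgebra K A) (n : ℕ) : Submodule K A :=
  Submodule.span K {x | ∃ i j, 0 < i ∧ 0 < j ∧ i + j = n ∧
    ∃ a ∈ gradedPart 𝒜 R i, ∃ b ∈ gradedPart 𝒜 R j, a * b = x}

/-- `X` is a family of homogeneous elements of positive degrees which, in each degree `n`,
is a basis of a complement of the decomposable elements of `R`. -/
structure IsMinimalGenerators (𝒜 : ℕ → Submodule K A) (R : Subalgebra K A)
    (d : ι → ℕ) (X : ι → A) : Prop where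
  pos : ∀ i, 0 < d i
  mem : ∀ i, X i ∈ gradedPart 𝒜 R (d i)
  indep : ∀ n, LinearIndepOn K X {i | d i = n}
  disjoint : ∀ n, Disjoint (Submodule.span K (X '' {i | d i = n})) (decomposables 𝒜 R n)
  le_sup : ∀ n, 0 < n →
    gradedPart 𝒜 R n ≤ Submodule.span K (X '' {i | d i = n}) ⊔ decomposables 𝒜 R n

theorem exists_isMinimalGenerators (𝒜 : ℕ → Submodule K A) [∀ n, Module.Finite K (𝒜 n)]
    (R : Subalgebra K A) :
    ∃ (ι : Type) (d : ι → ℕ) (X : ι → A), IsMinimalGenerators 𝒜 R d X := by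
  have hC (n : ℕ) : ∃ C : Submodule K A, C ≤ gradedPart 𝒜 R n ∧
      Disjoint C (decomposables 𝒜 R n) ∧ gradedPart 𝒜 R n ≤ C ⊔ decomposables 𝒜 R n := by
    obtain ⟨E, hE⟩ :=
      Submodule.exists_isCompl ((decomposables 𝒜 R n).comap (gradedPart 𝒜 R n).subtype)
    refine ⟨E.map (gradedPart 𝒜 R n).subtype, Submodule.map_subtype_le _ _, ?_, ?_⟩
    · rw [Submodule.disjoint_def]
      rintro _ ⟨x, hx, rfl⟩ hxD
      rw [Submodule.disjoint_def.mp hE.disjoint x hxD hx, map_zero]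
    · intro x hx
      obtain ⟨u, hu, v, hv, huv⟩ := Submodule.mem_sup.mp
        (hE.sup_eq_top.ge (Submodule.mem_top (x := (⟨x, hx⟩ : gradedPart 𝒜 R n))))
      have : x = v + u := by
        rw [add_comm]; exact (congrArg Subtype.val huv).symm
      rw [this]
      exact Submodule.add_mem_sup ⟨v, hv, rfl⟩ hu
  choose C hCle hCdisj hCsup using hC
  have hfin (n : ℕ) : Module.Finite K (C n) :=
    Module.Finite.of_injective (Submodule.inclusion ((hCle n).trans inf_le_right))
      (Submodule.inclusion_injective _)
  let X : (Σ n : ℕ, Fin (Module.finrank K (C (n + 1)))) → A :=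
    fun i => (Module.finBasis K (C (i.1 + 1)) i.2 : A)
  have hset (n : ℕ) : {i : Σ n : ℕ, Fin (Module.finrank K (C (n + 1))) | i.1 + 1 = n + 1} =
      Set.range (Sigma.mk n) := by
    ext ⟨k, i⟩
    constructor
    · intro h
      obtain rfl : k = n := by simpa using h
      exact ⟨i, rfl⟩
    · rintro ⟨j, hj⟩
      simp [← hj]
  have hset0 : {i : Σ n : ℕ, Fin (Module.finrank K (C (n + 1))) | i.1 + 1 = 0} = ∅ := by
    ext; simp
  have hspan (n : ℕ) : Submodule.span K (X '' {i | i.1 + 1 = n + 1}) = C (n + 1) := by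
    rw [hset, ← Set.range_comp]
    have : X ∘ Sigma.mk n = (C (n + 1)).subtype ∘ Module.finBasis K (C (n + 1)) := rfl
    rw [this, Set.range_comp, Submodule.span_image, (Module.finBasis K (C (n + 1))).span_eq,
      Submodule.map_subtype_top]
  refine ⟨_, fun i => i.1 + 1, X, fun i => i.1.succ_pos, fun i => hCle _ (Subtype.coe_prop _),
    fun n => ?_, fun n => ?_, fun n hn => ?_⟩
  · rcases n with _ | n
    · rw [hset0]; exact linearIndepOn_empty K X
    · rw [hset, linearIndepOn_range_iff sigma_mk_injective]
      exact (Module.finBasis K (C (n + 1))).linearIndependent.map' _ (Submodule.ker_subtype _)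
  · rcases n with _ | n
    · rw [hset0]; simp
    · rw [hspan]; exact hCdisj _
  · obtain ⟨n, rfl⟩ := Nat.exists_eq_succ_of_ne_zero hn.ne'
    rw [Nat.succ_eq_add_one, hspan]; exact hCsup _

namespace IsMinimalGenerators

variable {𝒜 : ℕ → Submodule K A} {R : Subalgebra K A} {d : ι → ℕ} {X : ι → A}

theorem gradedPart_le_adjoin (hX : IsMinimalGenerators 𝒜 R d X) (h0 : 𝒜 0 = 1) (n : ℕ) :
    gradedPart 𝒜 R n ≤ Subalgebra.toSubmodule (Algebra.adjoin K (Set.range X)) := by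
  induction n using Nat.strong_induction_on with
  | _ n ih =>
    rcases n.eq_zero_or_pos with rfl | hn
    · intro x hx
      have hx0 : x ∈ 𝒜 0 := hx.2
      rw [h0] at hx0
      obtain ⟨c, rfl⟩ := Submodule.mem_one.mp hx0
      exact Subalgebra.algebraMap_mem _ c
    · refine (hX.le_sup n hn).trans (sup_le ?_ ?_)
      · rw [Submodule.span_le]
        rintro _ ⟨i, -, rfl⟩
        exact Algebra.subset_adjoin ⟨i, rfl⟩
      · rw [decomposables, Submodule.span_le]
        rintro _ ⟨i, j, hi, hj, hij, a, ha, b, hb, rfl⟩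
        exact Subalgebra.mul_mem _ (ih i (by lia) ha) (ih j (by lia) hb)

/-- In a homogeneous right relation between minimal generators, the coefficients of the generators
of top degree vanish. -/
theorem coeff_eq_zero (hX : IsMinimalGenerators 𝒜 R d X) (h0 : 𝒜 0 = 1)
    {n : ℕ} {s : Finset ι} {c : ι → A} (hd : ∀ i ∈ s, d i ≤ n)
    (hc : ∀ i ∈ s, c i ∈ gradedPart 𝒜 R (n - d i)) (hsum : ∑ i ∈ s, X i * c i = 0)
    {i : ι} (hi : i ∈ s) (hin : d i = n) : c i = 0 := by
  classical
  have hscal (j : ι) : ∃ r : K, j ∈ s → d j = n → c j = algebraMap K A r := by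
    by_cases hj : j ∈ s ∧ d j = n
    · have hcj := (hc j hj.1).2
      rw [hj.2, Nat.sub_self, h0] at hcj
      obtain ⟨r, hr⟩ := Submodule.mem_one.mp hcj
      exact ⟨r, fun _ _ => hr.symm⟩
    · exact ⟨0, fun h h' => absurd ⟨h, h'⟩ hj⟩
  choose r hr using hscal
  have hsplit : ∑ j ∈ s with d j = n, r j • X j = -∑ j ∈ s with ¬ d j = n, X j * c j := by
    rw [← Finset.sum_filter_add_sum_filter_not s (fun j => d j = n)] at hsum
    rw [← eq_neg_iff_add_eq_zero.mpr hsum]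
    refine Finset.sum_congr rfl fun j hj => ?_
    rw [Finset.mem_filter] at hj
    rw [hr j hj.1 hj.2, Algebra.smul_def, Algebra.commutes]
  have hzero : ∑ j ∈ s with d j = n, r j • X j = 0 := by
    refine Submodule.disjoint_def.mp (hX.disjoint n) _ ?_ ?_
    · refine Submodule.sum_smul_mem _ _ fun j hj => Submodule.subset_span ⟨j, ?_, rfl⟩
      exact (Finset.mem_filter.mp hj).2
    · rw [hsplit]
      refine neg_mem (sum_mem fun j hj => Submodule.subset_span ?_)
      rw [Finset.mem_filter] at hj
      have := hd j hj.1
      exact ⟨d j, n - d j, hX.pos j, by lia, by lia, X j, hX.mem j, c j, hc j hj.1, rfl⟩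
  have hli : LinearIndepOn K X (s.filter fun j => d j = n : Finset ι) :=
    (hX.indep n).mono fun j hj => (Finset.mem_filter.mp hj).2
  rw [hr i hi hin, linearIndepOn_finset_iff.mp hli r hzero i (by simp [hi, hin]), map_zero]

end IsMinimalGenerators

/-- A graded algebra in which every nonzero homogeneous element can be turned into `1` by a
degree lowering operator which is left linear on elements of sufficiently high degree. -/
def HasTransductions (𝒜 : ℕ → Submodule K A) : Prop :=
  ∀ k, ∀ b ∈ 𝒜 k, b ≠ 0 → ∃ τ : A →ₗ[K] A, τ b = 1 ∧
    ∀ j, ∀ b' ∈ 𝒜 (j + k), τ b' ∈ 𝒜 j ∧ ∀ a, τ (a * b') = a * τ b'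

/-- A homogeneous projection onto `R` which is left `R`-linear. -/
structure IsReynolds (𝒜 : ℕ → Submodule K A) (R : Subalgebra K A) (ρ : A →ₗ[K] A) : Prop where
  mem : ∀ a, ρ a ∈ R
  map_one : ρ 1 = 1
  map_mul : ∀ a ∈ R, ∀ b, ρ (a * b) = a * ρ b
  map_mem : ∀ n, ∀ a ∈ 𝒜 n, ρ a ∈ 𝒜 n

variable {𝒜 : ℕ → Submodule K A} {R : Subalgebra K A} {d : ι → ℕ} {X : ι → A} {ρ : A →ₗ[K] A}

theorem IsReynolds.decompose_mem [GradedAlgebra 𝒜] (hρ : IsReynolds 𝒜 R ρ) {a : A} (ha : a ∈ R)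
    (n : ℕ) : (decompose 𝒜 a n : A) ∈ gradedPart 𝒜 R n := by
  classical
  refine ⟨?_, Subtype.coe_prop _⟩
  have key (b : A) : (decompose 𝒜 (ρ b) n : A) = ρ (decompose 𝒜 b n) := by
    induction b using DirectSum.Decomposition.inductionOn 𝒜 with
    | zero => simp
    | @homogeneous i b =>
      rcases eq_or_ne i n with rfl | h
      · rw [decompose_of_mem_same 𝒜 b.2, decompose_of_mem_same 𝒜 (hρ.map_mem i b b.2)]
      · rw [decompose_of_mem_ne 𝒜 b.2 h, decompose_of_mem_ne 𝒜 (hρ.map_mem i b b.2) h, map_zero]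
    | add b c hb hc => simp [hb, hc]
  have hρa : ρ a = a := by simpa [hρ.map_one] using hρ.map_mul a ha 1
  rw [← hρa, key]
  exact hρ.mem _

/-- Homogeneous right independence of minimal generators. -/
theorem IsMinimalGenerators.eq_zero_of_homogeneous_relation
    (hX : IsMinimalGenerators 𝒜 R d X) (h0 : 𝒜 0 = 1) (hτ : HasTransductions 𝒜)
    (hρ : IsReynolds 𝒜 R ρ) {N : ℕ} {s : Finset ι} {b : ι → A} (hd : ∀ i ∈ s, d i ≤ N)
    (hb : ∀ i ∈ s, b i ∈ gradedPart 𝒜 R (N - d i)) (hsum : ∑ i ∈ s, X i * b i = 0) :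
    ∀ i ∈ s, b i = 0 := by
  classical
  by_contra! hne
  obtain ⟨i, hi, hmax⟩ := (s.filter fun i => b i ≠ 0).exists_max_image d
    (by simpa [Finset.filter_nonempty_iff] using hne)
  rw [Finset.mem_filter] at hi
  obtain ⟨τ, hτ1, hτ⟩ := hτ _ (b i) (hb i hi.1).2 hi.2
  have hmem : ∀ j ∈ s.filter (fun i => b i ≠ 0), b j ∈ 𝒜 (d i - d j + (N - d i)) := by
    intro j hj
    have h1 := hmax j hj
    have h2 := hd i hi.1
    have h3 := (hb j (Finset.mem_filter.mp hj).1).2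
    rwa [show N - d j = d i - d j + (N - d i) by lia] at h3
  have hrel : ∑ j ∈ s with b j ≠ 0, X j * b j = 0 := by
    refine (Finset.sum_filter_of_ne fun j _ hj h => ?_).trans hsum
    exact hj (by rw [h, mul_zero])
  have hzero := hX.coeff_eq_zero h0 (n := d i) (s := s.filter fun i => b i ≠ 0)
    (c := fun j => ρ (τ (b j))) hmax
    (fun j hj => ⟨hρ.mem _, hρ.map_mem _ _ (hτ _ _ (hmem j hj)).1⟩)
    (by
      have := congrArg (fun x => ρ (τ x)) hrel
      simp only [map_sum, map_zero] at this
      refine Eq.trans (Finset.sum_congr rfl fun j hj => ?_) this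
      rw [(hτ _ _ (hmem j hj)).2, hρ.map_mul _ (hX.mem j).1])
    (Finset.mem_filter.mpr hi) rfl
  simp only [hτ1, hρ.map_one] at hzero
  exact hi.2 (by rw [← mul_one (b i), hzero, mul_zero])

/-- Right independence of minimal generators. -/
theorem IsMinimalGenerators.rightIndependent [GradedAlgebra 𝒜] [Nontrivial A]
    (hX : IsMinimalGenerators 𝒜 R d X) (h0 : 𝒜 0 = 1) (hτ : HasTransductions 𝒜)
    (hρ : IsReynolds 𝒜 R ρ) (c : K) (s : Finset ι) (b : ι → A) (hb : ∀ i, b i ∈ R)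
    (hsum : algebraMap K A c + ∑ i ∈ s, X i * b i = 0) : c = 0 ∧ ∀ i ∈ s, b i = 0 := by
  classical
  have hcomp (n : ℕ) : (decompose 𝒜 (algebraMap K A c) n : A) +
      ∑ i ∈ s with d i ≤ n, X i * (decompose 𝒜 (b i) (n - d i) : A) = 0 := by
    have := congrArg (GradedRing.proj 𝒜 n) hsum
    rw [map_add, map_sum, map_zero] at this
    simp only [GradedRing.proj_apply] at this
    rw [← this, Finset.sum_filter]
    congr 1
    exact Finset.sum_congr rfl fun i _ => (coe_decompose_mul_of_left_mem 𝒜 n (hX.mem i).2).symm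
  have hc : c = 0 := by
    have := hcomp 0
    rw [decompose_of_mem_same 𝒜 (by rw [h0]; exact Submodule.mem_one.mpr ⟨c, rfl⟩),
      Finset.filter_false_of_mem (fun i _ => by have := hX.pos i; lia), Finset.sum_empty,
      add_zero] at this
    simpa using this
  refine ⟨hc, fun i hi => ?_⟩
  have hzero (n : ℕ) : (decompose 𝒜 (b i) n : A) = 0 := by
    have := hX.eq_zero_of_homogeneous_relation h0 hτ hρ (N := n + d i)
      (s := s.filter fun j => d j ≤ n + d i)
      (b := fun j => (decompose 𝒜 (b j) (n + d i - d j) : A))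
      (fun j hj => (Finset.mem_filter.mp hj).2) (fun j _ => hρ.decompose_mem (hb j) _)
      (by simpa [hc] using hcomp (n + d i)) i (by simp [hi])
    rwa [Nat.add_sub_cancel] at this
  rw [← sum_support_decompose 𝒜 (b i)]
  exact Finset.sum_eq_zero fun n _ => hzero n

theorem IsMinimalGenerators.adjoin_eq [GradedAlgebra 𝒜] (hX : IsMinimalGenerators 𝒜 R d X)
    (h0 : 𝒜 0 = 1) (hρ : IsReynolds 𝒜 R ρ) : Algebra.adjoin K (Set.range X) = R := by
  classical
  refine le_antisymm (Algebra.adjoin_le ?_) fun a ha => ?_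
  · rintro _ ⟨i, rfl⟩
    exact (hX.mem i).1
  · rw [← sum_support_decompose 𝒜 a]
    exact sum_mem fun n _ => hX.gradedPart_le_adjoin h0 n (hρ.decompose_mem ha n)

end GradedGenerators

section Invariants

variable {K : Type*} [Field K] {m : ℕ}

theorem mem_freeInvariants {G : Subgroup (GL (Fin m) K)} {a : FreeAlgebra K (Fin m)} :
    a ∈ freeInvariants K G ↔ ∀ g ∈ G, freeAct K (g : Matrix (Fin m) (Fin m) K) a = a := by
  simp [freeInvariants, Algebra.mem_iInf]

theorem freeAct_mul (g h : Matrix (Fin m) (Fin m) K) :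
    freeAct K (g * h) = (freeAct K g).comp (freeAct K h) := by
  ext j
  simp only [freeAct, Function.comp_apply, AlgHom.comp_apply, FreeAlgebra.lift_ι_apply, map_sum,
    map_smul, Matrix.mul_apply, Finset.smul_sum, Finset.sum_smul, smul_smul]
  rw [Finset.sum_comm]
  exact Finset.sum_congr rfl fun i _ => Finset.sum_congr rfl fun k _ => by rw [mul_comm]

theorem freeAct_mem_pow (g : Matrix (Fin m) (Fin m) K) {n : ℕ} {a : FreeAlgebra K (Fin m)}
    (ha : a ∈ FreeAlgebra.linearPart K (Fin m) ^ n) :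
    freeAct K g a ∈ FreeAlgebra.linearPart K (Fin m) ^ n := by
  have hle : (FreeAlgebra.linearPart K (Fin m)).map (freeAct K g).toLinearMap ≤
      FreeAlgebra.linearPart K (Fin m) := by
    rw [Submodule.map_span_le]
    rintro _ ⟨j, rfl⟩
    simp only [freeAct, AlgHom.toLinearMap_apply, FreeAlgebra.lift_ι_apply]
    exact sum_mem fun i _ => Submodule.smul_mem _ _ (FreeAlgebra.ι_mem_linearPart K i)
  have := Submodule.mem_map_of_mem (f := (freeAct K g).toLinearMap) ha
  rw [Submodule.map_pow] at this
  exact pow_le_pow_left' hle n this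

/-- The averaging operator over a finite group of linear substitutions. -/
noncomputable def freeReynolds (G : Subgroup (GL (Fin m) K)) [Fintype G] :
    FreeAlgebra K (Fin m) →ₗ[K] FreeAlgebra K (Fin m) :=
  (Fintype.card G : K)⁻¹ •
    ∑ g : G, (freeAct K ((g : GL (Fin m) K) : Matrix (Fin m) (Fin m) K)).toLinearMap

theorem freeReynolds_apply (G : Subgroup (GL (Fin m) K)) [Fintype G] (a : FreeAlgebra K (Fin m)) :
    freeReynolds G a = (Fintype.card G : K)⁻¹ •
      ∑ g : G, freeAct K ((g : GL (Fin m) K) : Matrix (Fin m) (Fin m) K) a := by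
  simp [freeReynolds]

theorem isReynolds_freeReynolds [CharZero K] (G : Subgroup (GL (Fin m) K)) [Fintype G] :
    IsReynolds (FreeAlgebra.linearPart K (Fin m) ^ ·) (freeInvariants K G) (freeReynolds G) where
  mem a := by
    rw [mem_freeInvariants]
    intro h hh
    rw [freeReynolds_apply, map_smul, map_sum]
    congr 1
    refine Fintype.sum_equiv (Equiv.mulLeft (⟨h, hh⟩ : G)) _ _ fun g => ?_
    simp [freeAct_mul]
  map_one := by
    have : (Fintype.card G : K) ≠ 0 := by simp
    simp only [freeReynolds_apply, map_one, Finset.sum_const, Finset.card_univ]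
    rw [← Nat.cast_smul_eq_nsmul K, smul_smul, inv_mul_cancel₀ this, one_smul]
  map_mul a ha b := by
    rw [mem_freeInvariants] at ha
    rw [freeReynolds_apply, freeReynolds_apply, mul_smul_comm, Finset.mul_sum]
    congr 1
    exact Finset.sum_congr rfl fun g _ => by rw [map_mul, ha g g.2]
  map_mem n a ha := by
    rw [freeReynolds_apply]
    exact Submodule.smul_mem _ _ (sum_mem fun g _ => freeAct_mem_pow _ ha)

end Invariants

/-- **Lane–Kharchenko.** For every finite subgroup `G ≤ GL_m(K)`, the algebra of invariants
`K⟨x_1,…,x_m⟩^G` is a free associative algebra on some set of free generators. -/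
theorem freeInvariants_isFree {K : Type*} [Field K] [IsAlgClosed K] [CharZero K] {m : ℕ}
    (G : Subgroup (GL (Fin m) K)) [Fintype G] :
    ∃ X : Type, Nonempty ((freeInvariants K G) ≃ₐ[K] FreeAlgebra K X) := by
  have hfin (n : ℕ) : Module.Finite K (FreeAlgebra.linearPart K (Fin m) ^ n : Submodule K _) :=
    Module.Finite.iff_fg.mpr ((Submodule.fg_span (Set.finite_range _)).pow n)
  have hρ := isReynolds_freeReynolds G
  have h0 : FreeAlgebra.linearPart K (Fin m) ^ 0 = 1 := pow_zero _
  obtain ⟨X, d, x, hx⟩ := exists_isMinimalGenerators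
    (FreeAlgebra.linearPart K (Fin m) ^ ·) (freeInvariants K G)
  have hinj : Function.Injective (FreeAlgebra.lift K x) :=
    FreeAlgebra.lift_injective_of_rightIndependent (fun i => (hx.mem i).1)
      (hx.rightIndependent h0 (fun _ _ => FreeAlgebra.exists_transduction) hρ)
  have hrange : (FreeAlgebra.lift K x).range = freeInvariants K G := by
    rw [← Algebra.adjoin_range_eq_range_freeAlgebra_lift, hx.adjoin_eq h0 hρ]
  exact ⟨X, ⟨((AlgEquiv.ofInjective _ hinj).trans (Subalgebra.equivOfEq _ _ hrange)).symm⟩⟩
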